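/- Let κ ∈ H^{r+1} be real-valued and 2π-periodic with ‖κ‖_{H^{r+1}} ≤ R, r ≥ 0, and assume the least periodic eigenvalue of L_κ = -∂_s² + κ² is at least 1/4. Then there are constants C = C(r) and an integer ν = ν(r) (ν the least integer ≥ (r+1)/2 if r ≥ 1, and ν = 2 for 0 ≤ r < 1) such that for every f ∈ H^{r-1}, the unique periodic solution μ of L_κ μ = f satisfies ‖μ‖_{H^{r+1}} ≤ C (1+R²)^ν ‖f‖_{H^{r-1}}. -/

import Mathlib

open Real

/-- The n-th Fourier coefficient of a 2π-periodic function f : ℝ → ℂ. -/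
noncomputable def fc (f : ℝ → ℂ) (n : ℤ) : ℂ :=
  (2 * π : ℂ)⁻¹ * ∫ s in (0:ℝ)..(2 * π), Complex.exp (-(Complex.I * n * s)) * f s

/-- The periodic Sobolev H^r norm of f, via Fourier coefficients. -/
noncomputable def HnormR (r : ℝ) (f : ℝ → ℂ) : ℝ :=
  Real.sqrt (∑' n : ℤ, (1 + (n : ℝ) ^ 2) ^ r * ‖fc f n‖ ^ 2)

/-- Membership in the periodic Sobolev space H^r. -/
def MemH (r : ℝ) (f : ℝ → ℂ) : Prop :=
  Summable fun n : ℤ => (1 + (n : ℝ) ^ 2) ^ r * ‖fc f n‖ ^ 2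

section FourierCoefficients

lemma continuous_fourier_character (n : ℤ) :
    Continuous fun s : ℝ => Complex.exp (-(Complex.I * n * s)) := by fun_prop

lemma norm_fourier_character (n : ℤ) (s : ℝ) :
    ‖Complex.exp (-(Complex.I * n * s))‖ = 1 := by
  rw [show -(Complex.I * n * s) = ((-(n * s) : ℝ) : ℂ) * Complex.I by push_cast; ring]
  exact Complex.norm_exp_ofReal_mul_I _

lemma hasSum_fc {g : ℝ → ℂ} (hg : Continuous g) (hp : Function.Periodic g (2 * π))
    (hs : Summable (fc g)) (x : ℝ) :
    HasSum (fun n : ℤ => fc g n * Complex.exp (Complex.I * n * x)) (g x) := by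
  have : Fact (0 < 2 * π) := ⟨Real.two_pi_pos⟩
  let G : C(AddCircle (2 * π), ℂ) := ⟨hp.lift, continuous_coinduced_dom.mpr hg⟩
  have hc : fourierCoeff G = fc g := by
    funext n
    rw [fourierCoeff_eq_intervalIntegral _ n 0, fc, zero_add, Complex.real_smul]
    congr 1
    · push_cast; simp
    · refine intervalIntegral.integral_congr fun s _ => ?_
      simp only [fourier_coe_apply, smul_eq_mul]
      congr 2
      push_cast
      have : (π : ℂ) ≠ 0 := by exact_mod_cast Real.pi_ne_zero
      field_simp
  have h := has_pointwise_sum_fourier_series_of_summable (f := G) (by rwa [hc]) (x : AddCircle (2 * π))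
  rw [hc] at h
  change HasSum _ (G x)
  convert h using 2 with n
  rw [fourier_coe_apply, smul_eq_mul]
  congr 2
  push_cast
  have : (π : ℂ) ≠ 0 := by exact_mod_cast Real.pi_ne_zero
  field_simp

/-- The Fourier coefficients of a product are the convolution of the Fourier coefficients. -/
lemma hasSum_fc_mul {g h : ℝ → ℂ} (hg : Continuous g) (hp : Function.Periodic g (2 * π))
    (hs : Summable (fc g)) (hh : Continuous h) (n : ℤ) :
    HasSum (fun m : ℤ => fc g m * fc h (n - m)) (fc (fun s => g s * h s) n) := by
  have key : HasSum (fun m : ℤ => ∫ s in (0 : ℝ)..(2 * π),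
      Complex.exp (-(Complex.I * n * s)) * (fc g m * Complex.exp (Complex.I * m * s) * h s))
      (∫ s in (0 : ℝ)..(2 * π), Complex.exp (-(Complex.I * n * s)) * (g s * h s)) := by
    refine intervalIntegral.hasSum_integral_of_dominated_convergence
      (fun m s => ‖fc g m‖ * ‖h s‖) (fun m => ?_) (fun m => ?_) ?_ ?_ ?_
    · exact Continuous.aestronglyMeasurable (by fun_prop)
    · refine Filter.Eventually.of_forall fun s _ => ?_
      have := norm_fourier_character (-m) s
      rw [show -(Complex.I * ((-m : ℤ) : ℂ) * s) = Complex.I * m * s by push_cast; ring] at this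
      rw [norm_mul, norm_mul, norm_mul, norm_fourier_character, this, one_mul, mul_one]
    · exact Filter.Eventually.of_forall fun s _ => hs.norm.mul_right _
    · simp_rw [tsum_mul_right]
      exact Continuous.intervalIntegrable (by fun_prop) _ _
    · exact Filter.Eventually.of_forall fun s _ =>
        ((hasSum_fc hg hp hs s).mul_right _).mul_left _
  convert! key.mul_left (2 * π : ℂ)⁻¹ using 2 with m
  rw [fc.eq_1 h, mul_left_comm, ← intervalIntegral.integral_const_mul]
  congr 1
  refine intervalIntegral.integral_congr fun s _ => ?_
  have : Complex.exp (-(Complex.I * ((n - m : ℤ) : ℂ) * s))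
      = Complex.exp (-(Complex.I * n * s)) * Complex.exp (Complex.I * m * s) := by
    rw [← Complex.exp_add]; congr 1; push_cast; ring
  linear_combination fc g m * h s * this

lemma exists_norm_fc_le (g : ℝ → ℂ) : ∃ M : ℝ, 0 ≤ M ∧ ∀ n : ℤ, ‖fc g n‖ ≤ M := by
  refine ⟨‖(2 * π : ℂ)⁻¹‖ * |∫ s in (0 : ℝ)..(2 * π), ‖g s‖|, by positivity, fun n => ?_⟩
  rw [fc, norm_mul]
  gcongr
  refine (intervalIntegral.norm_integral_le_abs_integral_norm).trans_eq ?_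
  simp_rw [norm_mul, norm_fourier_character, one_mul]

lemma fc_sub {g h : ℝ → ℂ} (hg : Continuous g) (hh : Continuous h) (n : ℤ) :
    fc (fun s => g s - h s) n = fc g n - fc h n := by
  simp only [fc, mul_sub]
  rw [intervalIntegral.integral_sub, mul_sub]
  all_goals exact Continuous.intervalIntegrable (by fun_prop) _ _

lemma fc_ofReal_neg (u : ℝ → ℝ) (n : ℤ) :
    fc (fun s => (u s : ℂ)) (-n) = (starRingEnd ℂ) (fc (fun s => (u s : ℂ)) n) := by
  simp only [fc, map_mul, map_inv₀, intervalIntegral.integral_of_le Real.two_pi_pos.le,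
    ← integral_conj]
  congr 1
  · simp only [Complex.conj_ofReal, map_ofNat]
  · simp [← Complex.exp_conj]

lemma fc_deriv {g g' : ℝ → ℂ} (hd : ∀ s, HasDerivAt g (g' s) s) (hg' : Continuous g')
    (hp : Function.Periodic g (2 * π)) (n : ℤ) : fc g' n = Complex.I * n * fc g n := by
  have he : ∀ s : ℝ, HasDerivAt (fun s : ℝ => Complex.exp (-(Complex.I * n * s)))
      (-(Complex.I * n) * Complex.exp (-(Complex.I * n * s))) s := by
    intro s
    have h1 : HasDerivAt (fun s : ℝ => -(Complex.I * n * (s : ℂ))) (-(Complex.I * n)) s := by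
      simpa [Function.comp_def] using
        ((hasDerivAt_id (s : ℂ)).const_mul (Complex.I * n)).fun_neg.comp_ofReal
    simpa [mul_comm] using h1.cexp
  have hI := intervalIntegral.integral_mul_deriv_eq_deriv_mul
    (a := 0) (b := 2 * π) (fun s _ => he s) (fun s _ => hd s)
    (Continuous.intervalIntegrable (by fun_prop) _ _) (hg'.intervalIntegrable _ _)
  have h2 : Complex.exp (-(Complex.I * n * ((2 * π : ℝ) : ℂ))) = 1 := by
    rw [Complex.exp_eq_one_iff]
    exact ⟨-n, by push_cast; ring⟩
  have h3 : g (2 * π) = g 0 := by simpa using hp 0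
  rw [h2, h3] at hI
  simp only [fc, hI]
  simp_rw [mul_assoc (-(Complex.I * (n : ℂ)))]
  rw [intervalIntegral.integral_const_mul]
  simp
  ring

lemma fc_deriv_deriv {u : ℝ → ℝ} (hu : ContDiff ℝ 2 u) (hp : Function.Periodic u (2 * π)) (n : ℤ) :
    fc (fun s => ((deriv (deriv u) s : ℝ) : ℂ)) n = -(n : ℂ) ^ 2 * fc (fun s => (u s : ℂ)) n := by
  have hu' : ContDiff ℝ 1 (deriv u) := ((contDiff_succ_iff_deriv (n := 1)).1 hu).2.2
  have hd : ∀ s, HasDerivAt u (deriv u s) s := fun s =>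
    (hu.differentiable (by norm_num) s).hasDerivAt
  have hd' : ∀ s, HasDerivAt (deriv u) (deriv (deriv u) s) s := fun s =>
    (hu'.differentiable (by norm_num) s).hasDerivAt
  have hc' : Continuous (deriv u) := hu'.continuous
  have hc'' : Continuous (deriv (deriv u)) := hu'.continuous_deriv (by norm_num)
  rw [fc_deriv (fun s => (hd' s).ofReal_comp) (by fun_prop)
      (fun s => by rw [← deriv_comp_add_const, funext hp]),
    fc_deriv (fun s => (hd s).ofReal_comp) (by fun_prop) (fun s => by simp only [hp s])]
  linear_combination (n : ℂ) ^ 2 * fc (fun s => (u s : ℂ)) n * Complex.I_sq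

lemma hasSum_fc_mul_conj {u h : ℝ → ℝ} (hu : Continuous u) (hp : Function.Periodic u (2 * π))
    (hs : Summable (fc fun s => (u s : ℂ))) (hh : Continuous h) :
    HasSum (fun m : ℤ => (fc (fun s => (u s : ℂ)) m *
      (starRingEnd ℂ) (fc (fun s => (h s : ℂ)) m)).re)
      ((2 * π)⁻¹ * ∫ s in (0 : ℝ)..(2 * π), u s * h s) := by
  have := Complex.hasSum_re (hasSum_fc_mul (g := fun s => (u s : ℂ)) (h := fun s => (h s : ℂ))
    (by fun_prop) (fun s => by simp only [hp s]) hs (by fun_prop) 0)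
  simp_rw [zero_sub, fc_ofReal_neg] at this
  convert this using 1
  simp only [fc, ← Complex.ofReal_mul, Int.cast_zero, mul_zero, zero_mul, neg_zero,
    Complex.exp_zero, one_mul, intervalIntegral.integral_ofReal]
  norm_cast

end FourierCoefficients

section WeightedSequences

/-- **Cauchy-Schwarz inequality** for infinite sums of nonnegative reals, squared version. -/
lemma tsum_sq_le_tsum_mul_tsum {ι : Type*} {p u v : ι → ℝ} (hp : ∀ i, 0 ≤ p i)
    (hu : ∀ i, 0 ≤ u i) (hv : ∀ i, 0 ≤ v i) (h : ∀ i, p i ^ 2 = u i * v i)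
    (hsu : Summable u) (hsv : Summable v) :
    Summable p ∧ (∑' i, p i) ^ 2 ≤ (∑' i, u i) * ∑' i, v i := by
  have hU : 0 ≤ ∑' i, u i := tsum_nonneg hu
  have hV : 0 ≤ ∑' i, v i := tsum_nonneg hv
  have hfin (s : Finset ι) : ∑ i ∈ s, p i ≤ √((∑' i, u i) * ∑' i, v i) := by
    refine Real.le_sqrt_of_sq_le ?_
    refine (Finset.sum_sq_le_sum_mul_sum_of_sq_le_mul s (fun i _ => hu i) (fun i _ => hv i)
      (fun i _ => (h i).le)).trans ?_
    gcongr
    · exact Finset.sum_nonneg fun i _ => hv i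
    · exact hsu.sum_le_tsum s fun i _ => hu i
    · exact hsv.sum_le_tsum s fun i _ => hv i
  refine ⟨summable_of_sum_le hp hfin, ?_⟩
  have := pow_le_pow_left₀ (tsum_nonneg hp) (Real.tsum_le_of_sum_le hp hfin) 2
  rwa [Real.sq_sqrt (by positivity)] at this

lemma one_le_one_add_sq (n : ℤ) : (1 : ℝ) ≤ 1 + (n : ℝ) ^ 2 := by nlinarith [sq_nonneg (n : ℝ)]

lemma weight_pos (t : ℝ) (n : ℤ) : (0 : ℝ) < (1 + (n : ℝ) ^ 2) ^ t := by positivity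

lemma summable_inv_weight {t : ℝ} (ht : 1 ≤ t) :
    Summable fun n : ℤ => ((1 + (n : ℝ) ^ 2) ^ t)⁻¹ := by
  have h := ((Real.summable_one_div_int_add_rpow (1 / 2) 2).2 (by norm_num)).mul_left 2
  refine h.of_nonneg_of_le (fun n => by positivity) fun n => ?_
  have h1 : (1 + (n : ℝ) ^ 2) ≤ (1 + (n : ℝ) ^ 2) ^ t := by
    simpa using Real.rpow_le_rpow_of_exponent_le (one_le_one_add_sq n) ht
  have h2 : (0 : ℝ) < |(n : ℝ) + 1 / 2| := by
    rw [abs_pos]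
    intro h0
    have : (2 * n + 1 : ℤ) = 0 := by
      have : (2 * n + 1 : ℝ) = 0 := by linarith
      exact_mod_cast this
    omega
  refine (inv_anti₀ (by positivity) h1).trans ?_
  rw [show (2 : ℝ) = ((2 : ℕ) : ℝ) by norm_num, Real.rpow_natCast, sq_abs]
  rw [abs_pos] at h2
  rw [inv_eq_one_div, mul_one_div, div_le_div_iff₀ (by positivity) (by positivity)]
  push_cast
  nlinarith [sq_nonneg ((n : ℝ) - 1 / 2)]

lemma weight_le_add_weight {t : ℝ} (ht : 0 ≤ t) (n m : ℤ) :
    (1 + (n : ℝ) ^ 2) ^ t ≤ 4 ^ t *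
      ((1 + (m : ℝ) ^ 2) ^ t + (1 + ((n - m : ℤ) : ℝ) ^ 2) ^ t) := by
  have h : (1 + (n : ℝ) ^ 2) ≤
      4 * max (1 + (m : ℝ) ^ 2) (1 + ((n - m : ℤ) : ℝ) ^ 2) := by
    have h1 := le_max_left (1 + (m : ℝ) ^ 2) (1 + ((n - m : ℤ) : ℝ) ^ 2)
    have h2 := le_max_right (1 + (m : ℝ) ^ 2) (1 + ((n - m : ℤ) : ℝ) ^ 2)
    push_cast at h1 h2 ⊢
    nlinarith [sq_nonneg ((n : ℝ) - 2 * m)]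
  refine (Real.rpow_le_rpow (by positivity) h ht).trans ?_
  rw [Real.mul_rpow (by norm_num) (by positivity)]
  gcongr
  rcases max_choice (1 + (m : ℝ) ^ 2) (1 + ((n - m : ℤ) : ℝ) ^ 2) with h | h <;> rw [h]
  · exact le_add_of_nonneg_right (weight_pos t _).le
  · exact le_add_of_nonneg_left (weight_pos t _).le

lemma hasSum_convolution {A B : ℤ → ℝ} (hA : ∀ n, 0 ≤ A n) (hB : ∀ n, 0 ≤ B n)
    (hsA : Summable A) (hsB : Summable B) :
    (∀ n, Summable fun m => A m * B (n - m)) ∧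
      HasSum (fun n => ∑' m, A m * B (n - m)) ((∑' n, A n) * ∑' n, B n) := by
  let e : ℤ × ℤ ≃ ℤ × ℤ :=
    { toFun := fun p => (p.2, p.1 - p.2)
      invFun := fun p => (p.1 + p.2, p.1)
      left_inv := fun p => by ext <;> simp
      right_inv := fun p => by ext <;> simp }
  have hs : Summable fun p : ℤ × ℤ => A p.1 * B p.2 := hsA.mul_of_nonneg hsB hA hB
  have hs' : Summable fun p : ℤ × ℤ => A p.2 * B (p.1 - p.2) := e.summable_iff.2 hs
  refine ⟨fun n => hs'.prod_factor n, ?_⟩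
  have h1 := hs'.prod.hasSum
  have h2 : ∑' p : ℤ × ℤ, A p.2 * B (p.1 - p.2) = ∑' p : ℤ × ℤ, A p.1 * B p.2 :=
    e.tsum_eq (fun p : ℤ × ℤ => A p.1 * B p.2)
  rwa [← hs'.tsum_prod, h2, ← hsA.tsum_mul_tsum hsB hs] at h1

/-- Weighted `ℓ²` is an algebra under convolution when the weight is quasi-subadditive with
summable inverse. -/
lemma weighted_convolution_le {w : ℤ → ℝ} {K : ℝ} (hwp : ∀ n, 0 < w n)
    (hsw : Summable fun n => (w n)⁻¹)
    (hw : ∀ n m, w n ≤ K * (w m + w (n - m))) {a b : ℤ → ℝ} (ha : ∀ n, 0 ≤ a n)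
    (hb : ∀ n, 0 ≤ b n) (hsa : Summable fun n => w n * a n ^ 2)
    (hsb : Summable fun n => w n * b n ^ 2) :
    (∀ n, Summable fun m => a m * b (n - m)) ∧
    (Summable fun n : ℤ => w n * (∑' m, a m * b (n - m)) ^ 2) ∧
    ∑' n : ℤ, w n * (∑' m, a m * b (n - m)) ^ 2 ≤ K * (2 * ∑' n : ℤ, (w n)⁻¹) *
      ((∑' n : ℤ, w n * a n ^ 2) * ∑' n : ℤ, w n * b n ^ 2) := by
  obtain ⟨hc, hsum⟩ := hasSum_convolution (A := fun n => w n * a n ^ 2)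
    (B := fun n => w n * b n ^ 2) (fun n => by have := hwp n; positivity)
    (fun n => by have := hwp n; positivity) hsa hsb
  have hsw' (n : ℤ) : HasSum (fun m => (w m)⁻¹ + (w (n - m))⁻¹) (2 * ∑' n, (w n)⁻¹) := by
    rw [two_mul]
    exact hsw.hasSum.add ((Equiv.subLeft n).hasSum_iff.2 hsw.hasSum)
  have hle (n m : ℤ) :
      (w m * w (n - m))⁻¹ ≤ K * (w n)⁻¹ * ((w m)⁻¹ + (w (n - m))⁻¹) := by
    have h := hw n m
    have h1 := hwp n
    have h2 := hwp m
    have h3 := hwp (n - m)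
    rw [show K * (w n)⁻¹ * ((w m)⁻¹ + (w (n - m))⁻¹)
      = (w m * w (n - m))⁻¹ * ((w n)⁻¹ * (K * (w m + w (n - m)))) by field_simp; ring]
    refine le_mul_of_one_le_right (by positivity) ?_
    rw [inv_mul_eq_div, one_le_div h1]
    exact h
  have hsu (n : ℤ) : Summable fun m => (w m * w (n - m))⁻¹ :=
    ((hsw' n).summable.mul_left _).of_nonneg_of_le
      (fun m => by have := hwp m; have := hwp (n - m); positivity) (hle n)
  have hcs (n : ℤ) := tsum_sq_le_tsum_mul_tsum (p := fun m => a m * b (n - m))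
    (u := fun m => (w m * w (n - m))⁻¹) (v := fun m => w m * a m ^ 2 * (w (n - m) * b (n - m) ^ 2))
    (fun m => mul_nonneg (ha _) (hb _))
    (fun m => by have := hwp m; have := hwp (n - m); positivity)
    (fun m => by have := hwp m; have := hwp (n - m); positivity)
    (fun m => by have := hwp m; have := hwp (n - m); field_simp) (hsu n) (hc n)
  have hbd (n : ℤ) : w n * (∑' m, a m * b (n - m)) ^ 2 ≤ K * (2 * ∑' n : ℤ, (w n)⁻¹) *
      ∑' m, w m * a m ^ 2 * (w (n - m) * b (n - m) ^ 2) := by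
    have h1 := hwp n
    have h2 : ∑' m, (w m * w (n - m))⁻¹ ≤ K * (w n)⁻¹ * (2 * ∑' n : ℤ, (w n)⁻¹) := by
      rw [← (hsw' n).tsum_eq, ← tsum_mul_left]
      exact (hsu n).tsum_le_tsum (hle n) ((hsw' n).summable.mul_left _)
    have h3 : 0 ≤ ∑' m, w m * a m ^ 2 * (w (n - m) * b (n - m) ^ 2) :=
      tsum_nonneg fun m => by have := hwp m; have := hwp (n - m); positivity
    calc w n * (∑' m, a m * b (n - m)) ^ 2
        ≤ w n * ((K * (w n)⁻¹ * (2 * ∑' n : ℤ, (w n)⁻¹)) *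
          ∑' m, w m * a m ^ 2 * (w (n - m) * b (n - m) ^ 2)) := by
          gcongr
          exact (hcs n).2.trans (by gcongr)
      _ = _ := by field_simp
  have hs := hsum.summable.mul_left (K * (2 * ∑' n : ℤ, (w n)⁻¹))
  have hs2 := hs.of_nonneg_of_le (fun n => by have := hwp n; positivity) hbd
  refine ⟨fun n => (hcs n).1, hs2, (hs2.tsum_le_tsum hbd hs).trans_eq ?_⟩
  rw [tsum_mul_left, hsum.tsum_eq]

end WeightedSequences

section Sobolev

/-- The square of the periodic Sobolev norm. -/
noncomputable def sobolevSq (r : ℝ) (f : ℝ → ℂ) : ℝ :=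
  ∑' n : ℤ, (1 + (n : ℝ) ^ 2) ^ r * ‖fc f n‖ ^ 2

lemma sobolevSq_nonneg (r : ℝ) (f : ℝ → ℂ) : 0 ≤ sobolevSq r f :=
  tsum_nonneg fun n => by positivity

lemma MemH.mono {r s : ℝ} {f : ℝ → ℂ} (h : MemH r f) (hs : s ≤ r) : MemH s f :=
  Summable.of_nonneg_of_le (fun n => by positivity)
    (fun n => by gcongr; exact one_le_one_add_sq n) h

lemma MemH.sobolevSq_mono {r s : ℝ} {f : ℝ → ℂ} (h : MemH r f) (hs : s ≤ r) :
    sobolevSq s f ≤ sobolevSq r f :=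
  (h.mono hs).tsum_le_tsum (fun n => by gcongr; exact one_le_one_add_sq n) h

lemma MemH.summable_fc {t : ℝ} (ht : 1 ≤ t) {f : ℝ → ℂ} (h : MemH t f) : Summable (fc f) := by
  refine Summable.of_norm_bounded ((summable_inv_weight ht).add h) fun n => ?_
  have hw := weight_pos t n
  set w := (1 + (n : ℝ) ^ 2) ^ t
  set x := ‖fc f n‖
  have hx : 0 ≤ x := norm_nonneg _
  have h1 : w⁻¹ + w * x ^ 2 - 2 * x = w⁻¹ * (1 - w * x) ^ 2 := by field_simp; ring
  have h2 : 0 ≤ w⁻¹ * (1 - w * x) ^ 2 := by positivity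
  linarith

/-- The periodic Sobolev space `H^t` is an algebra for `1 ≤ t`. -/
lemma exists_sobolevSq_mul_le {t : ℝ} (ht : 1 ≤ t) : ∃ K : ℝ, 0 ≤ K ∧ ∀ g h : ℝ → ℂ,
    Continuous g → Function.Periodic g (2 * π) → Continuous h → MemH t g → MemH t h →
    MemH t (fun s => g s * h s) ∧
      sobolevSq t (fun s => g s * h s) ≤ K * (sobolevSq t g * sobolevSq t h) := by
  refine ⟨4 ^ t * (2 * ∑' n : ℤ, ((1 + (n : ℝ) ^ 2) ^ t)⁻¹), ?_, fun g h hg hp hh hmg hmh => ?_⟩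
  · have : 0 ≤ ∑' n : ℤ, ((1 + (n : ℝ) ^ 2) ^ t)⁻¹ := tsum_nonneg fun n => by positivity
    positivity
  obtain ⟨h1, h2, h3⟩ := weighted_convolution_le (w := fun n => (1 + (n : ℝ) ^ 2) ^ t)
    (weight_pos t) (summable_inv_weight ht) (weight_le_add_weight (by linarith))
    (fun n => norm_nonneg (fc g n)) (fun n => norm_nonneg (fc h n)) hmg hmh
  have hle (n : ℤ) : (1 + (n : ℝ) ^ 2) ^ t * ‖fc (fun s => g s * h s) n‖ ^ 2 ≤
      (1 + (n : ℝ) ^ 2) ^ t * (∑' m, ‖fc g m‖ * ‖fc h (n - m)‖) ^ 2 := by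
    gcongr
    rw [← (hasSum_fc_mul hg hp (hmg.summable_fc ht) hh n).tsum_eq]
    simp_rw [← norm_mul]
    exact norm_tsum_le_tsum_norm (by simpa only [norm_mul] using h1 n)
  have hm : MemH t (fun s => g s * h s) := h2.of_nonneg_of_le (fun n => by positivity) hle
  exact ⟨hm, (hm.tsum_le_tsum hle h2).trans h3⟩

/-- Elliptic regularity: two derivatives are gained on the right-hand side. -/
lemma exists_sobolevSq_add_two_le {t : ℝ} (ht : 1 ≤ t) : ∃ K : ℝ, 0 ≤ K ∧
    ∀ (s : ℝ) (κ f μ : ℝ → ℝ), s ≤ t → Continuous κ → Function.Periodic κ (2 * π) →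
      MemH t (fun s => (κ s : ℂ)) → Continuous f → MemH s (fun s => (f s : ℂ)) →
      ContDiff ℝ 2 μ → Function.Periodic μ (2 * π) →
      (∀ s, -(deriv (deriv μ) s) + (κ s) ^ 2 * μ s = f s) →
      MemH t (fun s => (μ s : ℂ)) →
      MemH (s + 2) (fun s => (μ s : ℂ)) ∧ sobolevSq (s + 2) (fun s => (μ s : ℂ)) ≤
        3 * (sobolevSq s (fun s => (f s : ℂ)) +
          (K * sobolevSq t (fun s => (κ s : ℂ)) ^ 2 + 1) * sobolevSq t (fun s => (μ s : ℂ))) := by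
  obtain ⟨K, hK, hmul⟩ := exists_sobolevSq_mul_le ht
  refine ⟨K ^ 2, by positivity, fun s κ f μ hs hκ hκp hκm hf hfm hμ hμp heq hμm => ?_⟩
  have hμc : Continuous μ := hμ.continuous
  have hcκ : Continuous fun s => (κ s : ℂ) := by fun_prop
  have hcμ : Continuous fun s => (μ s : ℂ) := by fun_prop
  have hcf : Continuous fun s => (f s : ℂ) := by fun_prop
  have hpκ : Function.Periodic (fun s => (κ s : ℂ)) (2 * π) := fun s => by simp only [hκp s]
  obtain ⟨m1, b1⟩ := hmul _ _ hcκ hpκ hcμ hκm hμm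
  set P : ℝ → ℂ := fun s => (κ s : ℂ) * ((κ s : ℂ) * (μ s : ℂ)) with hP
  obtain ⟨m2, b2⟩ : MemH t P ∧ sobolevSq t P ≤ K * (sobolevSq t (fun s => (κ s : ℂ)) *
      sobolevSq t (fun s => (κ s : ℂ) * (μ s : ℂ))) := hmul _ _ hcκ hpκ (hcκ.mul hcμ) hκm m1
  have hcP : Continuous P := hcκ.mul (hcκ.mul hcμ)
  have hfc (n : ℤ) : (1 + (n : ℂ) ^ 2) * fc (fun s => (μ s : ℂ)) n =
      fc (fun s => (f s : ℂ)) n - fc P n + fc (fun s => (μ s : ℂ)) n := by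
    have h1 : (fun s => ((deriv (deriv μ) s : ℝ) : ℂ)) = fun s => P s - (f s : ℂ) := by
      funext s
      rw [← heq s, hP]
      push_cast
      ring
    have h2 := fc_deriv_deriv hμ hμp n
    rw [h1, fc_sub hcP hcf] at h2
    linear_combination h2
  have hle (n : ℤ) : (1 + (n : ℝ) ^ 2) ^ (s + 2) * ‖fc (fun s => (μ s : ℂ)) n‖ ^ 2 ≤
      3 * ((1 + (n : ℝ) ^ 2) ^ s * ‖fc (fun s => (f s : ℂ)) n‖ ^ 2 +
        (1 + (n : ℝ) ^ 2) ^ s * ‖fc P n‖ ^ 2 +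
        (1 + (n : ℝ) ^ 2) ^ s * ‖fc (fun s => (μ s : ℂ)) n‖ ^ 2) := by
    have h1 : (1 + (n : ℝ) ^ 2) * ‖fc (fun s => (μ s : ℂ)) n‖ ≤
        ‖fc (fun s => (f s : ℂ)) n‖ + ‖fc P n‖ + ‖fc (fun s => (μ s : ℂ)) n‖ := by
      have h2 : ‖(1 + (n : ℂ) ^ 2)‖ = 1 + (n : ℝ) ^ 2 := by
        rw [show (1 + (n : ℂ) ^ 2) = ((1 + (n : ℝ) ^ 2 : ℝ) : ℂ) by push_cast; ring,
          Complex.norm_real, Real.norm_of_nonneg (by positivity)]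
      rw [← h2, ← norm_mul, hfc]
      exact (norm_add_le _ _).trans (by gcongr; exact norm_sub_le _ _)
    have hw := weight_pos s n
    rw [Real.rpow_add (by positivity), Real.rpow_two]
    set x := ‖fc (fun s => (f s : ℂ)) n‖
    set y := ‖fc P n‖
    set z := ‖fc (fun s => (μ s : ℂ)) n‖
    have h3 : ((1 + (n : ℝ) ^ 2) * z) ^ 2 ≤ 3 * (x ^ 2 + y ^ 2 + z ^ 2) :=
      (pow_le_pow_left₀ (by positivity) h1 2).trans
        (by nlinarith [sq_nonneg (x - y), sq_nonneg (y - z), sq_nonneg (x - z)])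
    calc _ = (1 + (n : ℝ) ^ 2) ^ s * ((1 + (n : ℝ) ^ 2) * z) ^ 2 := by ring
      _ ≤ (1 + (n : ℝ) ^ 2) ^ s * (3 * (x ^ 2 + y ^ 2 + z ^ 2)) := by gcongr
      _ = _ := by ring
  have hsum := ((hfm.hasSum.add (m2.mono hs).hasSum).add (hμm.mono hs).hasSum).mul_left 3
  have hm : MemH (s + 2) (fun s => (μ s : ℂ)) :=
    hsum.summable.of_nonneg_of_le (fun n => by positivity) hle
  refine ⟨hm, ((hm.tsum_le_tsum hle hsum.summable).trans_eq hsum.tsum_eq).trans ?_⟩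
  have b3 := m2.sobolevSq_mono hs
  have b4 := hμm.sobolevSq_mono hs
  have b5 : sobolevSq t P ≤ K ^ 2 * sobolevSq t (fun s => (κ s : ℂ)) ^ 2 *
      sobolevSq t (fun s => (μ s : ℂ)) := by
    refine b2.trans ?_
    have := sobolevSq_nonneg t (fun s => (κ s : ℂ))
    calc _ ≤ K * (sobolevSq t (fun s => (κ s : ℂ)) * (K * (sobolevSq t (fun s => (κ s : ℂ)) *
          sobolevSq t (fun s => (μ s : ℂ))))) := by gcongr
      _ = _ := by ring
  change 3 * (sobolevSq s _ + sobolevSq s P + sobolevSq s _) ≤ _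
  linarith

end Sobolev

section Energy

lemma summable_fc_of_contDiff {u : ℝ → ℝ} (hu : ContDiff ℝ 2 u)
    (hp : Function.Periodic u (2 * π)) : Summable (fc fun s => (u s : ℂ)) := by
  obtain ⟨M, hM, h1⟩ := exists_norm_fc_le fun s => (u s : ℂ)
  obtain ⟨M', hM', h2⟩ := exists_norm_fc_le fun s => ((deriv (deriv u) s : ℝ) : ℂ)
  refine Summable.of_norm_bounded ((summable_inv_weight le_rfl).mul_left (M + M')) fun n => ?_
  have h3 := h2 n
  rw [fc_deriv_deriv hu hp, norm_mul, norm_neg, norm_pow, Complex.norm_intCast, sq_abs] at h3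
  rw [Real.rpow_one, ← div_eq_mul_inv, le_div_iff₀ (by positivity)]
  linarith [h1 n]

/-- The energy estimate: the coercive operator `-∂² + κ²` has a bounded inverse `H⁻¹ → H¹`. -/
lemma energy_estimate {κ f μ : ℝ → ℝ} (hκ : Continuous κ)
    (hspec : (1 / 4) * ∫ s in (0 : ℝ)..(2 * π), (μ s) ^ 2 ≤
      ∫ s in (0 : ℝ)..(2 * π), ((deriv μ s) ^ 2 + (κ s) ^ 2 * (μ s) ^ 2))
    (hf : Continuous f) (hfm : MemH (-1) (fun s => (f s : ℂ)))
    (hμ : ContDiff ℝ 2 μ) (hμp : Function.Periodic μ (2 * π))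
    (heq : ∀ s, -(deriv (deriv μ) s) + (κ s) ^ 2 * μ s = f s) :
    MemH 1 (fun s => (μ s : ℂ)) ∧ sobolevSq 1 (fun s => (μ s : ℂ)) ≤
      25 * sobolevSq (-1) (fun s => (f s : ℂ)) := by
  have hμ' : ContDiff ℝ 1 (deriv μ) := ((contDiff_succ_iff_deriv (n := 1)).1 hμ).2.2
  have hd : ∀ s, HasDerivAt μ (deriv μ s) s := fun s =>
    (hμ.differentiable (by norm_num) s).hasDerivAt
  have hd' : ∀ s, HasDerivAt (deriv μ) (deriv (deriv μ) s) s := fun s =>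
    (hμ'.differentiable (by norm_num) s).hasDerivAt
  have hc : Continuous μ := hμ.continuous
  have hc' : Continuous (deriv μ) := hμ'.continuous
  have hc'' : Continuous (deriv (deriv μ)) := hμ'.continuous_deriv (by norm_num)
  have hsμ := summable_fc_of_contDiff hμ hμp
  set a : ℤ → ℂ := fc fun s => (μ s : ℂ)
  set b : ℤ → ℂ := fc fun s => (f s : ℂ)
  have hparts : ∫ s in (0 : ℝ)..(2 * π), (deriv μ s) ^ 2 =
      -∫ s in (0 : ℝ)..(2 * π), μ s * deriv (deriv μ) s := by
    have h := intervalIntegral.integral_mul_deriv_eq_deriv_mul (a := 0) (b := 2 * π)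
      (fun s _ => hd s) (fun s _ => hd' s)
      (hc'.intervalIntegrable _ _) (hc''.intervalIntegrable _ _)
    have h1 : μ (2 * π) = μ 0 := by simpa using hμp 0
    have h2 : deriv μ (2 * π) = deriv μ 0 := by
      rw [← zero_add (2 * π), ← deriv_comp_add_const, funext hμp]
    rw [h, h1, h2]
    simp [sq]
  have henergy : ∫ s in (0 : ℝ)..(2 * π), ((deriv μ s) ^ 2 + (κ s) ^ 2 * (μ s) ^ 2) =
      ∫ s in (0 : ℝ)..(2 * π), μ s * f s := by
    have h1 : ∀ s, (deriv μ s) ^ 2 + (κ s) ^ 2 * (μ s) ^ 2 =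
        (deriv μ s) ^ 2 + (μ s * f s + μ s * deriv (deriv μ) s) := fun s => by
      rw [← heq s]; ring
    simp_rw [h1]
    rw [intervalIntegral.integral_add, intervalIntegral.integral_add, hparts]
    · ring
    all_goals exact Continuous.intervalIntegrable (by fun_prop) _ _
  have hgrad : ∫ s in (0 : ℝ)..(2 * π), (deriv μ s) ^ 2 ≤
      ∫ s in (0 : ℝ)..(2 * π), ((deriv μ s) ^ 2 + (κ s) ^ 2 * (μ s) ^ 2) := by
    refine intervalIntegral.integral_mono Real.two_pi_pos.le
      (Continuous.intervalIntegrable (by fun_prop) _ _)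
      (Continuous.intervalIntegrable (by fun_prop) _ _) fun s => ?_
    have : 0 ≤ (κ s) ^ 2 * (μ s) ^ 2 := by positivity
    simpa using this
  have h0 : HasSum (fun n => ‖a n‖ ^ 2)
      ((2 * π)⁻¹ * ∫ s in (0 : ℝ)..(2 * π), (μ s) ^ 2) := by
    convert! hasSum_fc_mul_conj hc hμp hsμ hc using 2 with n
    · rw [Complex.mul_conj, Complex.ofReal_re, Complex.normSq_eq_norm_sq]
    · simp_rw [sq]
  have h1 : HasSum (fun n : ℤ => (n : ℝ) ^ 2 * ‖a n‖ ^ 2)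
      ((2 * π)⁻¹ * ∫ s in (0 : ℝ)..(2 * π), (deriv μ s) ^ 2) := by
    rw [hparts, mul_neg]
    convert! (hasSum_fc_mul_conj hc hμp hsμ hc'').neg using 2 with n
    rw [fc_deriv_deriv hμ hμp, map_mul, map_neg, map_pow, map_intCast, mul_left_comm,
      Complex.mul_conj, Complex.normSq_eq_norm_sq]
    norm_cast
    simp [a]
  have hf' := hasSum_fc_mul_conj hc hμp hsμ hf
  have hX : HasSum (fun n : ℤ => (1 + (n : ℝ) ^ 2) ^ (1 : ℝ) * ‖a n‖ ^ 2)
      ((2 * π)⁻¹ * (∫ s in (0 : ℝ)..(2 * π), (μ s) ^ 2) +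
        (2 * π)⁻¹ * ∫ s in (0 : ℝ)..(2 * π), (deriv μ s) ^ 2) := by
    convert! h0.add h1 using 2 with n
    rw [Real.rpow_one]; ring
  have hm : MemH 1 (fun s => (μ s : ℂ)) := hX.summable
  refine ⟨hm, ?_⟩
  obtain ⟨hs, hcs⟩ := tsum_sq_le_tsum_mul_tsum (p := fun n => ‖a n‖ * ‖b n‖)
    (u := fun n : ℤ => (1 + (n : ℝ) ^ 2) ^ (1 : ℝ) * ‖a n‖ ^ 2)
    (v := fun n : ℤ => (1 + (n : ℝ) ^ 2) ^ (-1 : ℝ) * ‖b n‖ ^ 2)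
    (fun n => by positivity) (fun n => by positivity) (fun n => by positivity)
    (fun n => by
      have : (0 : ℝ) < 1 + (n : ℝ) ^ 2 := by positivity
      rw [Real.rpow_neg this.le, Real.rpow_one]
      field_simp) hm hfm
  change _ ≤ sobolevSq 1 _ * sobolevSq (-1) _ at hcs
  have hpair : (2 * π)⁻¹ * (∫ s in (0 : ℝ)..(2 * π), μ s * f s) ≤ ∑' n, ‖a n‖ * ‖b n‖ := by
    rw [← hf'.tsum_eq]
    refine hf'.summable.tsum_le_tsum (fun n => ?_) hs
    refine (Complex.re_le_norm _).trans_eq ?_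
    rw [norm_mul, RCLike.norm_conj]
  have hpi : (0 : ℝ) < (2 * π)⁻¹ := by positivity
  have hX5 : sobolevSq 1 (fun s => (μ s : ℂ)) ≤ 5 * ∑' n, ‖a n‖ * ‖b n‖ := by
    rw [sobolevSq, hX.tsum_eq]
    rw [henergy] at hgrad hspec
    have e1 := mul_le_mul_of_nonneg_left hgrad hpi.le
    have e2 := mul_le_mul_of_nonneg_left hspec hpi.le
    linarith
  have hX0 := sobolevSq_nonneg 1 (fun s => (μ s : ℂ))
  have hF0 := sobolevSq_nonneg (-1) (fun s => (f s : ℂ))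
  by_contra! hlt
  have hpos : 0 < sobolevSq 1 (fun s => (μ s : ℂ)) := by linarith
  have := pow_le_pow_left₀ hX0 hX5 2
  nlinarith

end Energy

/-- Resolvent bound in squared Sobolev norms, with one factor `(1 + R²)²` for every two
derivatives. -/
lemma exists_resolvent_bound (k : ℕ) : ∀ r : ℝ, 0 ≤ r → r ≤ 2 * k + 2 →
    ∃ C : ℝ, 0 < C ∧ ∀ (κ : ℝ → ℝ) (R : ℝ) (f μ : ℝ → ℝ),
      Continuous κ → Function.Periodic κ (2 * π) →
      MemH (r + 1) (fun s => (κ s : ℂ)) →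
      sobolevSq (r + 1) (fun s => (κ s : ℂ)) ≤ R ^ 2 →
      ((1 / 4) * ∫ s in (0 : ℝ)..(2 * π), (μ s) ^ 2 ≤
        ∫ s in (0 : ℝ)..(2 * π), ((deriv μ s) ^ 2 + (κ s) ^ 2 * (μ s) ^ 2)) →
      Continuous f → MemH (r - 1) (fun s => (f s : ℂ)) →
      ContDiff ℝ 2 μ → Function.Periodic μ (2 * π) →
      (∀ s, -(deriv (deriv μ) s) + (κ s) ^ 2 * μ s = f s) →
      MemH (r + 1) (fun s => (μ s : ℂ)) ∧
        sobolevSq (r + 1) (fun s => (μ s : ℂ)) ≤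
          C * ((1 + R ^ 2) ^ (k + 1)) ^ 2 * sobolevSq (r - 1) (fun s => (f s : ℂ)) := by
  have gain {r t : ℝ} (ht : 1 ≤ t) (hrt : r - 1 ≤ t) (htr : t ≤ r + 1) (j : ℕ) (D : ℝ)
      (hD : 0 < D) : ∃ C : ℝ, 0 < C ∧ ∀ (κ : ℝ → ℝ) (R : ℝ) (f μ : ℝ → ℝ),
      Continuous κ → Function.Periodic κ (2 * π) →
      MemH (r + 1) (fun s => (κ s : ℂ)) →
      sobolevSq (r + 1) (fun s => (κ s : ℂ)) ≤ R ^ 2 →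
      Continuous f → MemH (r - 1) (fun s => (f s : ℂ)) →
      ContDiff ℝ 2 μ → Function.Periodic μ (2 * π) →
      (∀ s, -(deriv (deriv μ) s) + (κ s) ^ 2 * μ s = f s) →
      MemH t (fun s => (μ s : ℂ)) →
      sobolevSq t (fun s => (μ s : ℂ)) ≤
        D * ((1 + R ^ 2) ^ j) ^ 2 * sobolevSq (r - 1) (fun s => (f s : ℂ)) →
      MemH (r + 1) (fun s => (μ s : ℂ)) ∧
        sobolevSq (r + 1) (fun s => (μ s : ℂ)) ≤
          C * ((1 + R ^ 2) ^ (j + 1)) ^ 2 * sobolevSq (r - 1) (fun s => (f s : ℂ)) := by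
    obtain ⟨K, hK, h⟩ := exists_sobolevSq_add_two_le ht
    refine ⟨3 * (1 + (K + 1) * D), by positivity,
      fun κ R f μ hκ hκp hκm hκR hf hfm hμ hμp heq hμm hμb => ?_⟩
    obtain ⟨m, b⟩ := h (r - 1) κ f μ hrt hκ hκp (hκm.mono htr) hf hfm hμ hμp heq hμm
    rw [show r - 1 + 2 = r + 1 by ring] at m b
    refine ⟨m, b.trans ?_⟩
    have hκt := (hκm.sobolevSq_mono htr).trans hκR
    have hκ0 := sobolevSq_nonneg t (fun s => (κ s : ℂ))
    have hf0 := sobolevSq_nonneg (r - 1) (fun s => (f s : ℂ))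
    have hμ0 := sobolevSq_nonneg t (fun s => (μ s : ℂ))
    set F := sobolevSq (r - 1) (fun s => (f s : ℂ))
    set Q := sobolevSq t (fun s => (κ s : ℂ))
    set Y := sobolevSq t (fun s => (μ s : ℂ))
    have hone : (1 : ℝ) ≤ 1 + R ^ 2 := by nlinarith [sq_nonneg R]
    have hB : (1 : ℝ) ≤ ((1 + R ^ 2) ^ (j + 1)) ^ 2 := one_le_pow₀ (one_le_pow₀ hone)
    have hQ : K * Q ^ 2 + 1 ≤ (K + 1) * (1 + R ^ 2) ^ 2 := by
      have e1 : Q ^ 2 ≤ (1 + R ^ 2) ^ 2 := pow_le_pow_left₀ hκ0 (by linarith) 2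
      have e2 : (1 : ℝ) ≤ (1 + R ^ 2) ^ 2 := one_le_pow₀ hone
      nlinarith
    calc 3 * (F + (K * Q ^ 2 + 1) * Y)
        ≤ 3 * (((1 + R ^ 2) ^ (j + 1)) ^ 2 * F +
          ((K + 1) * (1 + R ^ 2) ^ 2) * (D * ((1 + R ^ 2) ^ j) ^ 2 * F)) := by
          gcongr
          exact le_mul_of_one_le_left hf0 hB
      _ = _ := by ring
  have base (r : ℝ) (hr : 0 ≤ r) (hr2 : r ≤ 2) := gain (r := r) (t := 1) le_rfl (by linarith)
    (by linarith) 0 25 (by norm_num)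
  induction k with
  | zero =>
    intro r hr hr2
    obtain ⟨C, hC, h⟩ := base r hr (by simpa using hr2)
    refine ⟨C, hC, fun κ R f μ hκ hκp hκm hκR hspec hf hfm hμ hμp heq => ?_⟩
    obtain ⟨m, b⟩ := energy_estimate hκ hspec hf (hfm.mono (by linarith)) hμ hμp heq
    refine h κ R f μ hκ hκp hκm hκR hf hfm hμ hμp heq m (b.trans ?_)
    simpa using hfm.sobolevSq_mono (s := -1) (by linarith)
  | succ k ih =>
    intro r hr hr2
    rcases le_or_gt r 2 with hr' | hr'
    · obtain ⟨C, hC, h⟩ := ih r hr (by have : (0 : ℝ) ≤ k := by positivity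
                                       linarith)
      refine ⟨C, hC, fun κ R f μ hκ hκp hκm hκR hspec hf hfm hμ hμp heq => ?_⟩
      obtain ⟨m, b⟩ := h κ R f μ hκ hκp hκm hκR hspec hf hfm hμ hμp heq
      refine ⟨m, b.trans ?_⟩
      have := sobolevSq_nonneg (r - 1) (fun s => (f s : ℂ))
      gcongr
      · nlinarith [sq_nonneg R]
      · omega
    · obtain ⟨D, hD, h⟩ := ih (r - 2) (by linarith) (by push_cast at hr2; linarith)
      obtain ⟨C, hC, hg⟩ := gain (r := r) (t := r - 1) (by linarith) le_rfl (by linarith)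
        (k + 1) D hD
      refine ⟨C, hC, fun κ R f μ hκ hκp hκm hκR hspec hf hfm hμ hμp heq => ?_⟩
      rw [show r - 2 + 1 = r - 1 by ring, show r - 2 - 1 = r - 3 by ring] at h
      obtain ⟨m, b⟩ := h κ R f μ hκ hκp (hκm.mono (by linarith))
        ((hκm.sobolevSq_mono (by linarith)).trans hκR) hspec hf (hfm.mono (by linarith)) hμ hμp heq
      refine hg κ R f μ hκ hκp hκm hκR hf hfm hμ hμp heq m (b.trans ?_)
      gcongr
      exact hfm.sobolevSq_mono (by linarith)

/-- Resolvent bound for L_κ = -∂_s² + κ²: if ‖κ‖_{H^{r+1}} ≤ R and the least periodic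
    eigenvalue of L_κ is ≥ 1/4, then the periodic solution μ of L_κ μ = f satisfies
    ‖μ‖_{H^{r+1}} ≤ C (1+R²)^ν ‖f‖_{H^{r-1}}, with ν = ⌈(r+1)/2⌉ for r ≥ 1 and ν = 2
    for 0 ≤ r < 1. -/
theorem stmt12 (r : ℝ) (hr : 0 ≤ r) :
    ∃ C : ℝ, 0 < C ∧ ∀ (κ : ℝ → ℝ) (R : ℝ) (f μ : ℝ → ℝ),
      Continuous κ → Function.Periodic κ (2 * π) →
      MemH (r + 1) (fun s => (κ s : ℂ)) →
      HnormR (r + 1) (fun s => (κ s : ℂ)) ≤ R →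
      (∀ ψ : ℝ → ℝ, ContDiff ℝ 2 ψ → Function.Periodic ψ (2 * π) →
        (1 / 4) * ∫ s in (0:ℝ)..(2 * π), (ψ s) ^ 2 ≤
          ∫ s in (0:ℝ)..(2 * π), ((deriv ψ s) ^ 2 + (κ s) ^ 2 * (ψ s) ^ 2)) →
      Continuous f → Function.Periodic f (2 * π) →
      MemH (r - 1) (fun s => (f s : ℂ)) →
      ContDiff ℝ 2 μ → Function.Periodic μ (2 * π) →
      (∀ s, -(deriv (deriv μ) s) + (κ s) ^ 2 * μ s = f s) →
      MemH (r + 1) (fun s => (μ s : ℂ)) ∧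
        HnormR (r + 1) (fun s => (μ s : ℂ)) ≤
          C * (1 + R ^ 2) ^ ((if 1 ≤ r then ⌈(r + 1) / 2⌉ else 2 : ℤ)) *
            HnormR (r - 1) (fun s => (f s : ℂ)) := by
  obtain ⟨C, hC, h⟩ := exists_resolvent_bound (⌈r / 2⌉₊ - 1) r hr (by
    have h1 := Nat.le_ceil (r / 2)
    have h2 : (⌈r / 2⌉₊ : ℝ) ≤ ((⌈r / 2⌉₊ - 1 : ℕ) : ℝ) + 1 := by
      exact_mod_cast (by omega : ⌈r / 2⌉₊ ≤ ⌈r / 2⌉₊ - 1 + 1)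
    linarith)
  refine ⟨√C, Real.sqrt_pos.2 hC,
    fun κ R f μ hκ hκp hκm hκR hspec hf _ hfm hμ hμp heq => ?_⟩
  have hR : sobolevSq (r + 1) (fun s => (κ s : ℂ)) ≤ R ^ 2 := (Real.sqrt_le_left
    ((Real.sqrt_nonneg _).trans hκR)).1 hκR
  obtain ⟨m, b⟩ := h κ R f μ hκ hκp hκm hR (hspec μ hμ hμp) hf hfm hμ hμp heq
  refine ⟨m, (Real.sqrt_le_sqrt b).trans ?_⟩
  rw [Real.sqrt_mul (by positivity), Real.sqrt_mul hC.le, Real.sqrt_sq (by positivity)]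
  change _ ≤ _ * HnormR (r - 1) (fun s => (f s : ℂ))
  have hone : (1 : ℝ) ≤ 1 + R ^ 2 := by nlinarith [sq_nonneg R]
  have hf0 : 0 ≤ HnormR (r - 1) (fun s => (f s : ℂ)) := Real.sqrt_nonneg _
  change √C * _ * HnormR (r - 1) (fun s => (f s : ℂ)) ≤ _
  gcongr
  rw [← zpow_natCast]
  refine zpow_le_zpow_right₀ hone ?_
  split_ifs with h1
  · have hpos : 0 < ⌈r / 2⌉₊ := Nat.ceil_pos.2 (by linarith)
    rw [Nat.sub_add_cancel hpos, Int.natCast_ceil_eq_ceil (by linarith)]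
    exact Int.ceil_mono (by linarith)
  · have : ⌈r / 2⌉₊ ≤ 1 := Nat.ceil_le.2 (by push_cast; linarith)
    omega
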